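/- Let (W,S) be an irreducible, infinite, non-affine Coxeter system of finite rank and let w ∈ W with w ≠ 1. Then the conjugacy class {gwg^{-1} : g ∈ W} of w is an infinite set. -/

import Mathlib

namespace CoxeterPaper

/-- The entry `-cos (π / m i j)` of the matrix of the standard bilinear form,
interpreted as `-1` when `m i j = ∞` (encoded as `0`). -/
noncomputable def formEntry {B : Type*} (M : CoxeterMatrix B) (i j : B) : ℝ :=
  if M i j = 0 then -1 else - Real.cos (Real.pi / (M i j : ℝ))

/-- The standard bilinear form associated to a Coxeter matrix, on `V = B → ℝ`
(with basis `{α_s : s ∈ S}` identified with the standard basis). -/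
noncomputable def bilin {B : Type*} [Fintype B] (M : CoxeterMatrix B) (v w : B → ℝ) : ℝ :=
  ∑ i, ∑ j, v i * w j * formEntry M i j

/-- The standard bilinear form is positive definite. -/
def IsPosDef {B : Type*} [Fintype B] (M : CoxeterMatrix B) : Prop :=
  ∀ v : B → ℝ, v ≠ 0 → 0 < bilin M v v

/-- The standard bilinear form is positive semidefinite. -/
def IsPosSemidef {B : Type*} [Fintype B] (M : CoxeterMatrix B) : Prop :=
  ∀ v : B → ℝ, 0 ≤ bilin M v v

/-- The Coxeter graph: vertices are the elements of `B`, and `i ≠ j` are adjacent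
iff `m i j ≥ 3` (including `m i j = ∞`, encoded as `0`), i.e. iff `m i j ≠ 2`. -/
def coxeterGraph {B : Type*} (M : CoxeterMatrix B) : SimpleGraph B :=
  SimpleGraph.fromRel fun i j => M i j ≠ 2

/-- A Coxeter matrix (system) is irreducible if its Coxeter graph is connected. -/
def IsIrreducible {B : Type*} (M : CoxeterMatrix B) : Prop := (coxeterGraph M).Connected

section FormEntries

variable {B : Type*} (M : CoxeterMatrix B)

lemma formEntry_symm (i j : B) : formEntry M i j = formEntry M j i := by
  simp only [formEntry, M.symmetric i j]

lemma formEntry_self (i : B) : formEntry M i i = 1 := by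
  simp [formEntry]

lemma two_le_of_ne {i j : B} (h : i ≠ j) (h0 : M i j ≠ 0) : 2 ≤ M i j := by
  have := M.off_diagonal i j h
  change M i j ≠ 1 at this
  omega

lemma formEntry_nonpos {i j : B} (h : i ≠ j) : formEntry M i j ≤ 0 := by
  unfold formEntry
  split_ifs with h0
  · norm_num
  · have h2 : (2 : ℝ) ≤ M i j := by exact_mod_cast two_le_of_ne M h h0
    have : 0 ≤ Real.cos (Real.pi / M i j) := by
      apply Real.cos_nonneg_of_mem_Icc
      constructor
      · have : 0 ≤ Real.pi / M i j := by positivity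
        linarith [Real.pi_pos]
      · exact div_le_div_of_nonneg_left Real.pi_pos.le (by norm_num) h2
    linarith

lemma neg_one_le_formEntry (i j : B) : -1 ≤ formEntry M i j := by
  unfold formEntry
  split_ifs with h0
  · norm_num
  · linarith [Real.cos_le_one (Real.pi / M i j)]

lemma formEntry_ne_zero_of_adj {i j : B} (h : (coxeterGraph M).Adj i j) :
    formEntry M i j ≠ 0 := by
  obtain ⟨hne, h2⟩ : i ≠ j ∧ (M i j ≠ 2 ∨ M j i ≠ 2) := by
    simpa [coxeterGraph] using h
  have h2' : M i j ≠ 2 := by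
    rcases h2 with h2 | h2
    · exact h2
    · rwa [M.symmetric]
  unfold formEntry
  split_ifs with h0
  · norm_num
  · have h3 : 3 ≤ M i j := by
      have := two_le_of_ne M hne h0
      omega
    have h3' : (3 : ℝ) ≤ M i j := by exact_mod_cast h3
    have : 0 < Real.cos (Real.pi / M i j) := by
      apply Real.cos_pos_of_mem_Ioo
      constructor
      · have : 0 ≤ Real.pi / M i j := by positivity
        linarith [Real.pi_pos]
      · exact div_lt_div_of_pos_left Real.pi_pos (by norm_num) (by linarith)
    linarith

/-- The coefficients of the roots of the rank two subsystem spanned by two distinct simple roots: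
a solution of the recurrence `p (k + 2) = 2 cos (π / m) p (k + 1) - p k`. -/
lemma exists_dihedral_coeff {i j : B} (h : i ≠ j) :
    ∃ p : ℕ → ℝ, p 0 = 0 ∧ p 1 = 1 ∧
      (∀ k, p (k + 2) = -2 * formEntry M i j * p (k + 1) - p k) ∧
      (∀ k, (M i j ≠ 0 → k ≤ M i j) → 0 ≤ p k) ∧
      (M i j ≠ 0 → p (2 * M i j) = 0 ∧ p (2 * M i j + 1) = 1) := by
  by_cases h0 : M i j = 0
  · refine ⟨fun k => k, by simp, by simp, ?_, fun k _ => by positivity, fun h => absurd h0 h⟩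
    intro k
    simp only [formEntry, h0, if_true]
    push_cast
    ring
  · have h2 := two_le_of_ne M h h0
    have h2' : (2 : ℝ) ≤ M i j := by exact_mod_cast h2
    set θ := Real.pi / M i j with hθ
    have hmθ : M i j * θ = Real.pi := by rw [hθ]; field_simp
    have hθ0 : 0 < θ := by rw [hθ]; have := Real.pi_pos; positivity
    have hs : 0 < Real.sin θ := by
      apply Real.sin_pos_of_pos_of_lt_pi hθ0
      nlinarith
    refine ⟨fun k => Real.sin (k * θ) / Real.sin θ, by simp, by simp [hs.ne'], ?_, ?_, ?_⟩
    · intro k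
      simp only [formEntry, h0, if_false]
      have e1 : ((k + 2 : ℕ) : ℝ) * θ = (k + 1 : ℕ) * θ + θ := by push_cast; ring
      have e2 : (k : ℝ) * θ = (k + 1 : ℕ) * θ - θ := by push_cast; ring
      rw [e1, e2, Real.sin_add, Real.sin_sub, ← hθ]
      field_simp
      ring
    · intro k hk
      have hk' : (k : ℝ) ≤ M i j := by exact_mod_cast hk h0
      refine div_nonneg (Real.sin_nonneg_of_nonneg_of_le_pi (by positivity) ?_) hs.le
      nlinarith
    · intro _
      constructor
      · have e : ((2 * M i j : ℕ) : ℝ) * θ = 2 * Real.pi := by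
          push_cast; rw [mul_assoc, hmθ]
        simp only [e, Real.sin_two_pi, zero_div]
      · have e : ((2 * M i j + 1 : ℕ) : ℝ) * θ = θ + 2 * Real.pi := by
          push_cast; rw [add_mul, mul_assoc, hmθ]; ring
        simp only [e, Real.sin_add_two_pi]
        exact div_self hs.ne'

end FormEntries

section Representation

variable {B : Type*} [Fintype B] (M : CoxeterMatrix B)

open Classical in
/-- The standard bilinear form as a bundled bilinear map. -/
noncomputable def stdForm : LinearMap.BilinForm ℝ (B → ℝ) :=
  Matrix.toBilin' (Matrix.of (formEntry M))

open Classical in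
/-- The simple root of an index, as a standard basis vector. -/
noncomputable def simpleRoot (i : B) : B → ℝ := Pi.single i 1

lemma stdForm_apply (v w : B → ℝ) : stdForm M v w = bilin M v w := by
  classical
  simp only [stdForm, bilin, Matrix.toBilin'_apply, Matrix.of_apply]
  exact Finset.sum_congr rfl fun i _ => Finset.sum_congr rfl fun j _ => by ring

lemma stdForm_comm (v w : B → ℝ) : stdForm M v w = stdForm M w v := by
  simp only [stdForm_apply, bilin]
  rw [Finset.sum_comm]
  refine Finset.sum_congr rfl fun i _ => Finset.sum_congr rfl fun j _ => ?_
  rw [formEntry_symm M i j]; ring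

lemma stdForm_root_root (i j : B) :
    stdForm M (simpleRoot i) (simpleRoot j) = formEntry M i j := by
  classical
  simp only [stdForm, simpleRoot]
  convert Matrix.toBilin'_single _ i j
  rfl

lemma stdForm_root_self (i : B) : stdForm M (simpleRoot i) (simpleRoot i) = 1 := by
  rw [stdForm_root_root, formEntry_self]

lemma sum_smul_simpleRoot (v : B → ℝ) : ∑ i, v i • simpleRoot i = v := by
  classical
  ext j
  simp [simpleRoot, Finset.sum_apply, Pi.single_apply]

lemma stdForm_eq_sum_left (v w : B → ℝ) :
    stdForm M v w = ∑ i, v i * stdForm M (simpleRoot i) w := by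
  conv_lhs => rw [← sum_smul_simpleRoot v]
  simp

/-- The reflection in a vector `a`, which is an isometry when `a` has norm one. -/
noncomputable def refl (a : B → ℝ) : Module.End ℝ (B → ℝ) :=
  LinearMap.id - (2 • stdForm M a).smulRight a

lemma refl_apply (a v : B → ℝ) : refl M a v = v - (2 * stdForm M a v) • a := by
  simp [refl, two_smul, two_mul]

variable {M}

lemma refl_refl {a : B → ℝ} (ha : stdForm M a a = 1) (v : B → ℝ) :
    refl M a (refl M a v) = v := by
  simp only [refl_apply, map_sub, map_smul, ha]
  module

lemma stdForm_refl_refl {a : B → ℝ} (ha : stdForm M a a = 1) (v w : B → ℝ) :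
    stdForm M (refl M a v) (refl M a w) = stdForm M v w := by
  simp only [refl_apply, map_sub, map_smul, ha, smul_eq_mul, LinearMap.sub_apply,
    LinearMap.smul_apply, stdForm_comm M v a]
  ring

lemma refl_root_self (i : B) :
    refl M (simpleRoot i) (simpleRoot i) = -simpleRoot i := by
  rw [refl_apply, stdForm_root_self]; module

lemma refl_mul_pow_apply_root {i j : B} {p : ℕ → ℝ} (h0 : p 0 = 0) (h1 : p 1 = 1)
    (hp : ∀ k, p (k + 2) = -2 * formEntry M i j * p (k + 1) - p k) (n : ℕ) :
    ((refl M (simpleRoot i) * refl M (simpleRoot j)) ^ n) (simpleRoot i) =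
      p (2 * n + 1) • simpleRoot i + p (2 * n) • simpleRoot j := by
  induction n with
  | zero => simp [h0, h1]
  | succ n ih =>
    rw [pow_succ', Module.End.mul_apply, ih]
    have e3 : p (2 * (n + 1) + 1) = _ := hp (2 * n + 1)
    have e2 : p (2 * (n + 1)) = _ := hp (2 * n)
    have e2' : p (2 * n + 1 + 1) = _ := hp (2 * n)
    rw [e3, e2', e2]
    simp only [Module.End.mul_apply, refl_apply, map_add, map_sub, map_smul,
      stdForm_root_root, formEntry_self, formEntry_symm M j i]
    module

lemma refl_mul_pow_apply_root_right {i j : B} (hij : i ≠ j) (hM : M i j ≠ 0) :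
    ((refl M (simpleRoot i) * refl M (simpleRoot j)) ^ M i j) (simpleRoot i) = simpleRoot i := by
  obtain ⟨p, h0, h1, hp, -, hm⟩ := exists_dihedral_coeff M hij
  rw [refl_mul_pow_apply_root h0 h1 hp, (hm hM).1, (hm hM).2]
  simp

lemma isLiftable_refl : M.IsLiftable fun i => refl M (simpleRoot i) := by
  intro i j
  have hsq (k : B) : refl M (simpleRoot k) * refl M (simpleRoot k) = 1 := by
    ext1 v
    exact refl_refl (stdForm_root_self M k) v
  by_cases hij : i = j
  · subst hij
    simp [hsq]
  by_cases hM : M i j = 0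
  · simp [hM]
  set T := refl M (simpleRoot i) * refl M (simpleRoot j)
  have hi : (T ^ M i j) (simpleRoot i) = simpleRoot i := refl_mul_pow_apply_root_right hij hM
  have hj : (T ^ M i j) (simpleRoot j) = simpleRoot j := by
    have hM' : M j i ≠ 0 := by rwa [M.symmetric]
    have h := refl_mul_pow_apply_root_right (Ne.symm hij) hM'
    rw [M.symmetric j i] at h
    have hinv : T ^ M i j * (refl M (simpleRoot j) * refl M (simpleRoot i)) ^ M i j = 1 := by
      have hTT : T * (refl M (simpleRoot j) * refl M (simpleRoot i)) = 1 := by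
        simp only [T]
        rw [mul_assoc, ← mul_assoc _ _ (refl M (simpleRoot i)), hsq, one_mul, hsq]
      have hTT' : (refl M (simpleRoot j) * refl M (simpleRoot i)) * T = 1 := by
        simp only [T]
        rw [mul_assoc, ← mul_assoc _ _ (refl M (simpleRoot j)), hsq, one_mul, hsq]
      rw [← Commute.mul_pow (hTT.trans hTT'.symm), hTT, one_pow]
    have := congrArg (fun f : Module.End ℝ (B → ℝ) => f (simpleRoot j)) hinv
    simpa [Module.End.mul_apply, h] using this
  have hfix : ∀ u : B → ℝ, stdForm M (simpleRoot i) u = 0 → stdForm M (simpleRoot j) u = 0 →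
      ∀ n, (T ^ n) u = u := by
    intro u hu hu' n
    induction n with
    | zero => simp
    | succ n ih =>
      rw [pow_succ', Module.End.mul_apply, ih]
      simp [T, Module.End.mul_apply, refl_apply, hu, hu']
  have hdet : 1 - formEntry M i j ^ 2 ≠ 0 := by
    simp only [formEntry, hM, if_false, neg_sq]
    have h2 : (2 : ℝ) ≤ M i j := by exact_mod_cast two_le_of_ne M hij hM
    have hs : 0 < Real.sin (Real.pi / M i j) := by
      have := Real.pi_pos
      apply Real.sin_pos_of_pos_of_lt_pi (by positivity)
      exact div_lt_self this (by linarith)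
    have := Real.sin_sq_add_cos_sq (Real.pi / M i j)
    have : 0 < Real.sin (Real.pi / M i j) ^ 2 := by positivity
    linarith
  ext1 v
  obtain ⟨a, b, u, hv, hu, hu'⟩ : ∃ (a b : ℝ) (u : B → ℝ),
      v = a • simpleRoot i + b • simpleRoot j + u ∧
      stdForm M (simpleRoot i) u = 0 ∧ stdForm M (simpleRoot j) u = 0 := by
    set c := formEntry M i j with hc
    set x := stdForm M (simpleRoot i) v with hx
    set y := stdForm M (simpleRoot j) v with hy
    refine ⟨(x - c * y) / (1 - c ^ 2), (y - c * x) / (1 - c ^ 2), _,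
      (add_sub_cancel _ v).symm, ?_, ?_⟩
    · simp only [map_sub, map_add, map_smul, stdForm_root_root, formEntry_self, smul_eq_mul,
        ← hc, ← hx]
      field_simp
      ring
    · simp only [map_sub, map_add, map_smul, stdForm_root_root, formEntry_self, smul_eq_mul,
        formEntry_symm M j i, ← hc, ← hy]
      field_simp
      ring
  change (T ^ M i j) v = v
  rw [hv]
  simp only [map_add, map_smul, hi, hj, hfix u hu hu']

end Representation
section GeometricRepresentation

variable {B W : Type*} [Fintype B] [Group W] {M : CoxeterMatrix B} (cs : CoxeterSystem M W)

/-- The geometric representation of a Coxeter group. -/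
noncomputable def geomRep : W →* Module.End ℝ (B → ℝ) :=
  cs.lift ⟨fun i => refl M (simpleRoot i), isLiftable_refl⟩

lemma geomRep_simple (i : B) : geomRep cs (cs.simple i) = refl M (simpleRoot i) :=
  cs.lift_apply_simple isLiftable_refl i

lemma geomRep_mul_apply (g h : W) (v : B → ℝ) :
    geomRep cs (g * h) v = geomRep cs g (geomRep cs h v) := by
  rw [map_mul, Module.End.mul_apply]

lemma geomRep_inv_apply_self (g : W) (v : B → ℝ) : geomRep cs g⁻¹ (geomRep cs g v) = v := by
  rw [← geomRep_mul_apply]; simp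

lemma stdForm_geomRep (g : W) (v w : B → ℝ) :
    stdForm M (geomRep cs g v) (geomRep cs g w) = stdForm M v w := by
  induction g using cs.simple_induction_left with
  | one => simp
  | mul_simple_left g i ih =>
    rw [geomRep_mul_apply, geomRep_mul_apply, geomRep_simple,
      stdForm_refl_refl (stdForm_root_self M i), ih]

lemma stdForm_geomRep_left (g : W) (v w : B → ℝ) :
    stdForm M (geomRep cs g v) w = stdForm M v (geomRep cs g⁻¹ w) := by
  rw [← stdForm_geomRep cs g v]
  congr 1
  rw [← geomRep_mul_apply]; simp

lemma geomRep_conj_simple (g : W) (i : B) :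
    geomRep cs (g * cs.simple i * g⁻¹) = refl M (geomRep cs g (simpleRoot i)) := by
  ext1 v
  rw [geomRep_mul_apply, geomRep_mul_apply, geomRep_simple, refl_apply, refl_apply,
    stdForm_geomRep_left, map_sub, map_smul, ← geomRep_mul_apply]
  simp

lemma geomRep_alternatingWord {i j : B} {p : ℕ → ℝ} (h0 : p 0 = 0) (h1 : p 1 = 1)
    (hp : ∀ k, p (k + 2) = -2 * formEntry M i j * p (k + 1) - p k) (k : ℕ) :
    geomRep cs (cs.wordProd (CoxeterSystem.alternatingWord i j k)) (simpleRoot i) =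
      if Even k then p (k + 1) • simpleRoot i + p k • simpleRoot j
      else p k • simpleRoot i + p (k + 1) • simpleRoot j := by
  induction k with
  | zero => simp [h0, h1, CoxeterSystem.alternatingWord]
  | succ k ih =>
    rw [CoxeterSystem.alternatingWord_succ', CoxeterSystem.wordProd_cons, geomRep_mul_apply, ih,
      geomRep_simple]
    have e : p (k + 1 + 1) = _ := hp k
    rw [e]
    by_cases hk : Even k
    · have hk' : ¬ Even (k + 1) := by simp [hk, parity_simps]
      simp only [hk, hk', if_true, if_false, refl_apply, map_add, map_smul, stdForm_root_root,
        formEntry_self, formEntry_symm M j i]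
      module
    · have hk' : Even (k + 1) := by simp [hk, parity_simps]
      simp only [hk, hk', if_true, if_false, refl_apply, map_add, map_smul, stdForm_root_root,
        formEntry_self]
      module

/-- An element `w` with `ℓ (w s) > ℓ w` maps the simple root of `s` to a positive root. -/
theorem geomRep_root_nonneg (w : W) (i : B) (hi : ¬ cs.IsRightDescent w i) :
    0 ≤ geomRep cs w (simpleRoot i) := by
  classical
  induction hn : cs.length w using Nat.strong_induction_on generalizing w i with
  | _ n IH =>
  have root_nonneg (k : B) : (0 : B → ℝ) ≤ simpleRoot k := by
    simp only [simpleRoot]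
    exact Pi.single_nonneg.2 zero_le_one
  by_cases hw : w = 1
  · simpa [hw] using root_nonneg i
  obtain ⟨j, hj⟩ := cs.exists_rightDescent_of_ne_one hw
  have hij : i ≠ j := by rintro rfl; exact hi hj
  have hex : ∃ l v, cs.length v = l ∧ ∃ k,
      w = v * cs.wordProd (CoxeterSystem.alternatingWord i j k) ∧ cs.length w = l + k :=
    ⟨_, w, rfl, 0, by simp [CoxeterSystem.alternatingWord], rfl⟩
  obtain ⟨v, hv, k, hwv, hlen⟩ := Nat.find_spec hex
  have hmin : ∀ v' k', w = v' * cs.wordProd (CoxeterSystem.alternatingWord i j k') →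
      cs.length w = cs.length v' + k' → cs.length v ≤ cs.length v' := by
    intro v' k' h1 h2
    rw [hv]
    exact Nat.find_min' hex ⟨v', rfl, k', h1, h2⟩
  rw [← hv] at hlen
  clear hv hex
  have hvw : cs.length v < cs.length w := by
    have := cs.isRightDescent_iff.1 hj
    have := hmin (w * cs.simple j) 1 (by simp [CoxeterSystem.alternatingWord]) this.symm
    have := cs.isRightDescent_iff.1 hj
    omega
  have hnext : ¬ cs.IsRightDescent v (if Even k then j else i) := by
    intro h
    have h' := cs.isRightDescent_iff.1 h
    have := hmin (v * cs.simple (if Even k then j else i)) (k + 1)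
      (by rw [CoxeterSystem.alternatingWord_succ', CoxeterSystem.wordProd_cons, hwv]
          simp [mul_assoc]) (by omega)
    omega
  have hprev : ¬ cs.IsRightDescent v (if Even k then i else j) := by
    intro h
    have h' := cs.isRightDescent_iff.1 h
    obtain ⟨k', rfl⟩ : ∃ k', k = k' + 1 := ⟨k - 1, by omega⟩
    have hpar : (if Even (k' + 1) then i else j) = if Even k' then j else i := by
      by_cases hk : Even k' <;> simp [hk, parity_simps]
    rw [hpar] at h'
    rw [CoxeterSystem.alternatingWord_succ', CoxeterSystem.wordProd_cons, ← mul_assoc] at hwv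
    have h1 := cs.length_mul_le (v * cs.simple (if Even k' then j else i))
      (cs.wordProd (CoxeterSystem.alternatingWord i j k'))
    rw [← hwv] at h1
    have h2 := cs.length_wordProd_le (CoxeterSystem.alternatingWord i j k')
    rw [CoxeterSystem.length_alternatingWord] at h2
    omega
  have hvij : ¬ cs.IsRightDescent v i ∧ ¬ cs.IsRightDescent v j := by
    by_cases hk : Even k <;> simp only [hk, if_true, if_false] at hnext hprev
    · exact ⟨hprev, hnext⟩
    · exact ⟨hnext, hprev⟩
  have hvi := IH _ (hn ▸ hvw) v i hvij.1 rfl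
  have hvj := IH _ (hn ▸ hvw) v j hvij.2 rfl
  have hkM : M i j ≠ 0 → k + 1 ≤ M i j := by
    intro hM
    by_contra hk
    have hM' : M j i ≠ 0 := by rwa [M.symmetric]
    have hred := cs.not_isReduced_alternatingWord j i (m := k + 1) hM'
      (by rw [M.symmetric j i]; omega)
    have h2 := cs.length_wordProd_le (CoxeterSystem.alternatingWord j i (k + 1))
    rw [CoxeterSystem.IsReduced] at hred
    rw [CoxeterSystem.length_alternatingWord] at h2 hred
    have h3 : w * cs.simple i = v * cs.wordProd (CoxeterSystem.alternatingWord j i (k + 1)) := by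
      rw [CoxeterSystem.alternatingWord_succ, CoxeterSystem.wordProd_concat, hwv, mul_assoc]
    have h1 := cs.length_mul_le v (cs.wordProd (CoxeterSystem.alternatingWord j i (k + 1)))
    rw [← h3, cs.not_isRightDescent_iff.1 hi] at h1
    omega
  obtain ⟨p, h0, h1, hp, hpos, -⟩ := exists_dihedral_coeff M hij
  have hk0 := hpos k fun hM => (Nat.le_succ k).trans (hkM hM)
  have hk1 := hpos (k + 1) hkM
  rw [hwv, geomRep_mul_apply, geomRep_alternatingWord cs h0 h1 hp]
  split_ifs
  · rw [map_add, map_smul, map_smul]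
    exact add_nonneg (smul_nonneg hk1 hvi) (smul_nonneg hk0 hvj)
  · rw [map_add, map_smul, map_smul]
    exact add_nonneg (smul_nonneg hk0 hvi) (smul_nonneg hk1 hvj)

lemma geomRep_root_nonpos (w : W) (i : B) (hi : cs.IsRightDescent w i) :
    geomRep cs w (simpleRoot i) ≤ 0 := by
  have h := geomRep_root_nonneg cs (w * cs.simple i) i
    (cs.isRightDescent_iff_not_isRightDescent_mul.1 hi)
  rw [geomRep_mul_apply, geomRep_simple, refl_root_self, map_neg] at h
  exact neg_nonneg.1 h

/-- The orbit of an antidominant vector `v` lies above `v`. -/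
lemma le_geomRep_of_antidominant {v : B → ℝ} (hv : ∀ i, stdForm M (simpleRoot i) v ≤ 0) (w : W) :
    v ≤ geomRep cs w v := by
  induction hn : cs.length w using Nat.strong_induction_on generalizing w with
  | _ n IH =>
  by_cases hw : w = 1
  · simp [hw]
  obtain ⟨i, hi⟩ := cs.exists_rightDescent_of_ne_one hw
  have h1 := IH _ (hn ▸ hi) (w * cs.simple i) rfl
  have h2 := geomRep_root_nonneg cs (w * cs.simple i) i
    (cs.isRightDescent_iff_not_isRightDescent_mul.1 hi)
  have h3 : geomRep cs w v = geomRep cs (w * cs.simple i) v +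
      (-2 * stdForm M (simpleRoot i) v) • geomRep cs (w * cs.simple i) (simpleRoot i) := by
    conv_lhs => rw [← cs.simple_mul_simple_cancel_right (w := w) i]
    rw [geomRep_mul_apply cs (w * cs.simple i), geomRep_simple, refl_apply, map_sub, map_smul]
    module
  rw [h3]
  exact h1.trans (le_add_of_nonneg_right (smul_nonneg (by linarith [hv i]) h2))

end GeometricRepresentation
section Perron

variable {B : Type*} [Fintype B] {M : CoxeterMatrix B}

lemma bilin_abs_le (u : B → ℝ) : bilin M |u| |u| ≤ bilin M u u := by
  refine Finset.sum_le_sum fun i _ => Finset.sum_le_sum fun j _ => ?_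
  by_cases hij : i = j
  · subst hij
    simp [Pi.abs_apply]
  · rw [Pi.abs_apply, Pi.abs_apply, ← abs_mul]
    exact mul_le_mul_of_nonpos_right (le_abs_self _) (formEntry_nonpos M hij)

/-- A Perron–Frobenius eigenvector for the Gram matrix of the standard form, in case the latter
takes negative values. -/
lemma exists_nonneg_eigenvector (h : ¬ IsPosSemidef M) :
    ∃ v : B → ℝ, 0 ≤ v ∧ v ≠ 0 ∧ ∃ μ : ℝ, 0 < μ ∧ ∀ i, stdForm M (simpleRoot i) v = -μ * v i := by
  simp only [IsPosSemidef, not_forall, not_le] at h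
  obtain ⟨v₀, hv₀⟩ := h
  have hsmul (r : ℝ) (x : B → ℝ) : bilin M (r • x) (r • x) = r ^ 2 * bilin M x x := by
    rw [← stdForm_apply, ← stdForm_apply]
    simp only [map_smul, LinearMap.smul_apply, smul_eq_mul]; ring
  have hsumsmul (r : ℝ) (x : B → ℝ) : ∑ i, (r • x) i ^ 2 = r ^ 2 * ∑ i, x i ^ 2 := by
    simp [Finset.mul_sum, mul_pow]
  have hpos (x : B → ℝ) (hx : x ≠ 0) : 0 < ∑ i, x i ^ 2 := by
    obtain ⟨i, hi⟩ := Function.ne_iff.1 hx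
    have hi' : x i ≠ 0 := hi
    exact Finset.sum_pos' (fun j _ => sq_nonneg _) ⟨i, Finset.mem_univ _, by positivity⟩
  have hnormalize (x : B → ℝ) (hx : x ≠ 0) : ∃ r : ℝ, r ^ 2 * ∑ i, x i ^ 2 = 1 := by
    refine ⟨(Real.sqrt (∑ i, x i ^ 2))⁻¹, ?_⟩
    rw [inv_pow, Real.sq_sqrt (hpos x hx).le]
    exact inv_mul_cancel₀ (hpos x hx).ne'
  set K : Set (B → ℝ) := {x | ∑ i, x i ^ 2 = 1} with hK
  have hKc : IsCompact K := by
    refine (isCompact_univ_pi fun _ : B => isCompact_Icc (a := (-1 : ℝ)) (b := 1)).of_isClosed_subset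
      (isClosed_eq (by fun_prop) continuous_const) ?_
    intro x hx i _
    have h1 : x i ^ 2 ≤ ∑ i, x i ^ 2 :=
      Finset.single_le_sum (f := fun i => x i ^ 2) (fun j _ => sq_nonneg _) (Finset.mem_univ i)
    rw [hx] at h1
    exact abs_le.1 (abs_le_one_iff_mul_self_le_one.2 (by nlinarith))
  have hcont : Continuous fun x : B → ℝ => bilin M x x := by
    unfold bilin
    fun_prop
  have hv₀0 : v₀ ≠ 0 := by
    rintro rfl
    simp [bilin] at hv₀
  obtain ⟨r₀, hr₀⟩ := hnormalize v₀ hv₀0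
  have hr₀K : r₀ • v₀ ∈ K := by
    change ∑ i, (r₀ • v₀) i ^ 2 = 1
    rw [hsumsmul, hr₀]
  obtain ⟨u, huK, hu⟩ := hKc.exists_isMinOn ⟨_, hr₀K⟩ hcont.continuousOn
  have hvK : ∑ i, |u| i ^ 2 = 1 := by
    have : ∑ i, u i ^ 2 = 1 := huK
    simpa [Pi.abs_apply] using this
  have hr₀0 : 0 < r₀ ^ 2 := by
    by_contra h0
    have : r₀ ^ 2 = 0 := le_antisymm (not_lt.1 h0) (sq_nonneg _)
    rw [this, zero_mul] at hr₀
    exact zero_ne_one hr₀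
  have hneg : bilin M |u| |u| < 0 := by
    refine (bilin_abs_le u).trans_lt ((hu hr₀K).trans_lt ?_)
    change bilin M (r₀ • v₀) (r₀ • v₀) < 0
    rw [hsmul]
    exact mul_neg_of_pos_of_neg hr₀0 hv₀
  have hmin (x : B → ℝ) : bilin M |u| |u| * ∑ i, x i ^ 2 ≤ bilin M x x := by
    by_cases hx : x = 0
    · simp [hx, bilin]
    obtain ⟨r, hr⟩ := hnormalize x hx
    have hrK : r • x ∈ K := by
      change ∑ i, (r • x) i ^ 2 = 1
      rw [hsumsmul, hr]
    have h1 : bilin M |u| |u| ≤ r ^ 2 * bilin M x x := by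
      rw [← hsmul]
      exact (bilin_abs_le u).trans (hu hrK)
    have h2 := hpos x hx
    calc bilin M |u| |u| * ∑ i, x i ^ 2 ≤ (r ^ 2 * bilin M x x) * ∑ i, x i ^ 2 :=
          mul_le_mul_of_nonneg_right h1 h2.le
      _ = (r ^ 2 * ∑ i, x i ^ 2) * bilin M x x := by ring
      _ = bilin M x x := by rw [hr, one_mul]
  refine ⟨|u|, abs_nonneg u, ?_, -bilin M |u| |u|, by linarith, fun i => ?_⟩
  · intro h0
    rw [h0] at hneg
    simp [bilin] at hneg
  · set v := |u|
    set m := bilin M v v with hm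
    have hsum (t : ℝ) : ∑ j, (v + t • simpleRoot i) j ^ 2 = 1 + 2 * t * v i + t ^ 2 := by
      classical
      have : ∀ j, (v + t • simpleRoot i) j ^ 2 =
          v j ^ 2 + if j = i then 2 * t * v i + t ^ 2 else 0 := by
        intro j
        by_cases hj : j = i
        · subst hj
          simp [simpleRoot]; ring
        · simp [simpleRoot, hj]
      simp only [this, Finset.sum_add_distrib, hvK]
      simp
      ring
    have hquad (t : ℝ) : 0 ≤ 2 * t * (stdForm M (simpleRoot i) v - m * v i) + t ^ 2 * (1 - m) := by
      have h1 := hmin (v + t • simpleRoot i)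
      rw [hsum, ← stdForm_apply] at h1
      simp only [map_add, map_smul, LinearMap.add_apply, LinearMap.smul_apply, smul_eq_mul,
        stdForm_root_self, stdForm_comm M v (simpleRoot i)] at h1
      rw [stdForm_apply M v v, ← hm] at h1
      linarith
    set d := stdForm M (simpleRoot i) v - m * v i with hd
    have h1 := hquad (-d / (1 - m))
    have hm1 : 0 < 1 - m := by linarith
    have h2 : 2 * (-d / (1 - m)) * d + (-d / (1 - m)) ^ 2 * (1 - m) = -(d ^ 2 / (1 - m)) := by
      field_simp
      ring
    rw [h2] at h1
    have h3 : d ^ 2 / (1 - m) ≤ 0 := by linarith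
    have h4 : d ^ 2 ≤ 0 := by
      by_contra h5
      exact absurd h3 (not_le.2 (div_pos (not_le.1 h5) hm1))
    have h6 : d = 0 := pow_eq_zero_iff (two_ne_zero) |>.1 (le_antisymm h4 (sq_nonneg d))
    linarith

lemma two_lt_card (h : ¬ IsPosSemidef M) : 2 < Fintype.card B := by
  classical
  by_contra hcard
  obtain ⟨v, hv, hv0, μ, hμ, heig⟩ := exists_nonneg_eigenvector h
  obtain ⟨i₀, hi₀⟩ := Function.ne_iff.1 hv0
  have : Nonempty B := ⟨i₀⟩
  obtain ⟨i, hi⟩ := Finite.exists_max v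
  have hvi : 0 < v i := ((hv i₀).lt_of_ne' hi₀).trans_le (hi i₀)
  have h1 : stdForm M (simpleRoot i) v = v i + ∑ j ∈ Finset.univ.erase i, v j * formEntry M i j := by
    rw [stdForm_comm, stdForm_eq_sum_left, ← Finset.add_sum_erase _ _ (Finset.mem_univ i)]
    simp only [stdForm_root_root, formEntry_self, mul_one, formEntry_symm M i]
  have h2 : ∑ j ∈ Finset.univ.erase i, -v i ≤
      ∑ j ∈ Finset.univ.erase i, v j * formEntry M i j := by
    refine Finset.sum_le_sum fun j _ => ?_
    have := neg_one_le_formEntry M i j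
    have := hi j
    have : 0 ≤ v j := hv j
    nlinarith
  rw [Finset.sum_const, Finset.card_erase_of_mem (Finset.mem_univ i), Finset.card_univ,
    nsmul_eq_mul] at h2
  have h3 : ((Fintype.card B - 1 : ℕ) : ℝ) ≤ 1 := by
    exact_mod_cast (by omega : Fintype.card B - 1 ≤ 1)
  have h4 := heig i
  nlinarith

end Perron

section Unbounded

variable {B W : Type*} [Fintype B] [Group W] {M : CoxeterMatrix B} (cs : CoxeterSystem M W)

/-- The orbits of the simple roots are not all bounded. -/
lemma exists_orbit_unbounded (h : ¬ IsPosSemidef M) (C : ℝ) :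
    ∃ i j, ∃ g : W, C < |stdForm M (simpleRoot i) (geomRep cs g (simpleRoot j))| := by
  obtain ⟨v, hv, hv0, μ, hμ, heig⟩ := exists_nonneg_eigenvector h
  have hform (x : B → ℝ) : stdForm M x v = -μ * ∑ i, x i * v i := by
    rw [stdForm_eq_sum_left, Finset.mul_sum]
    exact Finset.sum_congr rfl fun i _ => by rw [heig]; ring
  obtain ⟨i₀, hi₀⟩ := Function.ne_iff.1 hv0
  have hi₀' : v i₀ ≠ 0 := hi₀
  have : Nonempty B := ⟨i₀⟩
  set β := -stdForm M v v with hβ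
  have hβ0 : 0 < β := by
    rw [hβ, hform, neg_mul, neg_neg]
    refine mul_pos hμ (Finset.sum_pos' (fun j _ => mul_self_nonneg _)
      ⟨i₀, Finset.mem_univ _, mul_self_pos.2 hi₀'⟩)
  set n : ℝ := (Fintype.card B : ℝ) with hn
  have hn0 : 0 < n := by rw [hn]; exact_mod_cast Fintype.card_pos
  set δ := 2 * μ * (β / n) with hδ
  have hδ0 : 0 < δ := by positivity
  have hstep (k : ℕ) : ∃ g : W, stdForm M (geomRep cs g v) v ≤ -β - k * δ := by
    induction k with
    | zero => exact ⟨1, by simp [hβ]⟩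
    | succ k ih =>
      obtain ⟨g, hg⟩ := ih
      set x := geomRep cs g v
      obtain ⟨i, hi⟩ : ∃ i, v i * stdForm M (simpleRoot i) x ≤ -(β / n) := by
        by_contra! hcon
        have h1 : ∑ _i : B, -(β / n) < ∑ i, v i * stdForm M (simpleRoot i) x :=
          Finset.sum_lt_sum_of_nonempty Finset.univ_nonempty fun i _ => hcon i
        rw [← stdForm_eq_sum_left, Finset.sum_const, Finset.card_univ, nsmul_eq_mul, ← hn,
          stdForm_comm] at h1
        have h2 : n * -(β / n) = -β := by field_simp
        have h3 : 0 ≤ k * δ := by positivity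
        linarith
      refine ⟨cs.simple i * g, ?_⟩
      rw [geomRep_mul_apply, geomRep_simple, refl_apply]
      simp only [map_sub, map_smul, LinearMap.sub_apply, LinearMap.smul_apply, smul_eq_mul, heig]
      push_cast
      have : 2 * μ * (v i * stdForm M (simpleRoot i) x) ≤ 2 * μ * (-(β / n)) :=
        mul_le_mul_of_nonneg_left hi (by positivity)
      have e : 2 * μ * (-(β / n)) = -δ := by rw [hδ]; ring
      change stdForm M x v - 2 * stdForm M (simpleRoot i) x * (-μ * v i) ≤ _
      linarith
  by_contra! hcon
  have hbound (g : W) : |stdForm M (geomRep cs g v) v| ≤ ∑ i, ∑ j, v i * (v j * C) := by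
    have e : stdForm M (geomRep cs g v) v = ∑ i, ∑ j,
        v i * (v j * stdForm M (simpleRoot i) (geomRep cs g (simpleRoot j))) := by
      rw [stdForm_comm, stdForm_eq_sum_left]
      refine Finset.sum_congr rfl fun i _ => ?_
      rw [← Finset.mul_sum]
      congr 1
      conv_lhs => rw [← sum_smul_simpleRoot v]
      simp
    rw [e]
    refine (Finset.abs_sum_le_sum_abs _ _).trans (Finset.sum_le_sum fun i _ => ?_)
    refine (Finset.abs_sum_le_sum_abs _ _).trans (Finset.sum_le_sum fun j _ => ?_)
    rw [abs_mul, abs_mul, abs_of_nonneg (hv i), abs_of_nonneg (hv j)]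
    exact mul_le_mul_of_nonneg_left (mul_le_mul_of_nonneg_left (hcon i j g) (hv j)) (hv i)
  obtain ⟨k, hk⟩ := exists_nat_gt ((∑ i, ∑ j, v i * (v j * C)) / δ)
  obtain ⟨g, hg⟩ := hstep k
  have h1 := neg_le_of_abs_le (hbound g)
  rw [div_lt_iff₀ hδ0] at hk
  linarith

/-- In the irreducible case, the orbit of each simple root is unbounded in the direction of each
simple root. -/
lemma exists_lt_abs_stdForm (hirr : IsIrreducible M) (h : ¬ IsPosSemidef M) (i j : B) (C : ℝ) :
    ∃ g : W, C < |stdForm M (simpleRoot i) (geomRep cs g (simpleRoot j))| := by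
  let bdd (i j : B) : Prop :=
    ∃ C, ∀ g : W, |stdForm M (simpleRoot i) (geomRep cs g (simpleRoot j))| ≤ C
  have hsymm {i j : B} (hb : bdd i j) : bdd j i := by
    obtain ⟨C, hC⟩ := hb
    refine ⟨C, fun g => ?_⟩
    rw [stdForm_comm, stdForm_geomRep_left]
    exact hC _
  have hadj {i j k : B} (hjk : (coxeterGraph M).Adj j k) (hb : bdd i k) : bdd i j := by
    obtain ⟨C, hC⟩ := hb
    have hne := formEntry_ne_zero_of_adj M hjk
    refine ⟨C / |formEntry M j k|, fun g => ?_⟩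
    rw [le_div_iff₀ (abs_pos.2 hne)]
    have h1 := hC (g * cs.simple j)
    have h2 := hC g
    rw [geomRep_mul_apply, geomRep_simple, refl_apply, map_sub, map_smul, map_sub, map_smul,
      stdForm_root_root, smul_eq_mul] at h1
    rw [← abs_mul]
    rw [abs_le] at h1 h2 ⊢
    constructor <;> nlinarith
  have hright {i j : B} (hb : bdd i j) (k : B) : bdd i k := by
    obtain ⟨p⟩ := hirr.preconnected k j
    induction p with
    | nil => exact hb
    | cons hkl _ ih => exact hadj hkl (ih hb)
  by_contra! hcon
  have hall (k l : B) : bdd k l := hright (hsymm (hright ⟨C, hcon⟩ k)) l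
  choose D hD using hall
  obtain ⟨k, l, g, hg⟩ := exists_orbit_unbounded cs h (∑ k, ∑ l, |D k l|)
  have h1 : |D k l| ≤ ∑ k, ∑ l, |D k l| :=
    (Finset.single_le_sum (f := fun l => |D k l|) (fun _ _ => abs_nonneg _)
      (Finset.mem_univ l)).trans
    (Finset.single_le_sum (f := fun k => ∑ l, |D k l|)
      (fun _ _ => Finset.sum_nonneg fun _ _ => abs_nonneg _) (Finset.mem_univ k))
  linarith [hD k l g, le_abs_self (D k l)]

end Unbounded
section HyperbolicPlanes

variable {B W : Type*} [Fintype B] [Group W] {M : CoxeterMatrix B} (cs : CoxeterSystem M W)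

/-- If the roots `a` and `b` generate an infinite dihedral group of hyperbolic type, then the orbits
of this group are unbounded outside the orthogonal complement of `a` and `b`. -/
lemma stdForm_eq_zero_of_bounded {a b : B → ℝ} (hab : 1 < |stdForm M a b|) {X : Set (B → ℝ)}
    (hXa : ∀ x ∈ X, refl M a x ∈ X) (hXb : ∀ x ∈ X, refl M b x ∈ X) {A : ℝ}
    (hA : ∀ x ∈ X, |stdForm M a x| ≤ A) {x : B → ℝ} (hx : x ∈ X) :
    stdForm M a x = 0 ∧ stdForm M b x = 0 := by
  set c := stdForm M a b with hc
  have hb {A : ℝ} (hA : ∀ x ∈ X, |stdForm M a x| ≤ A) (x : B → ℝ) (hx : x ∈ X) :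
      |c * stdForm M b x| ≤ A := by
    have h1 := hA _ (hXb x hx)
    have h2 := hA x hx
    rw [refl_apply, map_sub, map_smul, smul_eq_mul, ← hc] at h1
    rw [abs_le] at h1 h2 ⊢
    constructor <;> linarith
  have ha {A : ℝ} (hA : ∀ x ∈ X, |stdForm M a x| ≤ A) (x : B → ℝ) (hx : x ∈ X) :
      c ^ 2 * |stdForm M a x| ≤ A := by
    have h1 := hb hA _ (hXa x hx)
    have h2 := hb hA x hx
    rw [refl_apply, map_sub, map_smul, smul_eq_mul, stdForm_comm M b a, ← hc] at h1
    rw [← abs_of_nonneg (sq_nonneg c), ← abs_mul]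
    rw [abs_le] at h1 h2 ⊢
    constructor <;> nlinarith
  have hc2 : 1 < c ^ 2 := by rw [← sq_abs]; nlinarith
  set S := (fun x => |stdForm M a x|) '' X
  have hbdd : BddAbove S := ⟨A, by rintro _ ⟨y, hy, rfl⟩; exact hA y hy⟩
  have hsup (y : B → ℝ) (hy : y ∈ X) : |stdForm M a y| ≤ sSup S :=
    le_csSup hbdd ⟨y, hy, rfl⟩
  have hle : sSup S ≤ sSup S / c ^ 2 := by
    refine csSup_le ⟨_, x, hx, rfl⟩ ?_
    rintro _ ⟨y, hy, rfl⟩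
    rw [le_div_iff₀ (by linarith), mul_comm]
    exact ha hsup y hy
  rw [le_div_iff₀ (by linarith)] at hle
  have hS0 : sSup S ≤ 0 := by nlinarith
  have hc0 : c ≠ 0 := by rintro h0; norm_num [h0] at hc2
  have ha0 : stdForm M a x = 0 := abs_nonpos_iff.1 ((hsup x hx).trans hS0)
  have hb0 : c * stdForm M b x = 0 := abs_nonpos_iff.1 ((hb hsup x hx).trans hS0)
  exact ⟨ha0, (mul_eq_zero.1 hb0).resolve_left hc0⟩

lemma refl_sub_mem {a : B → ℝ} {P : Submodule ℝ (B → ℝ)} (ha : a ∈ P) (v : B → ℝ) :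
    refl M a v - v ∈ P := by
  rw [refl_apply, sub_sub_cancel_left]
  exact P.neg_mem (P.smul_mem _ ha)

/-- An element commuting with a power of a hyperbolic product of two reflections preserves the plane
spanned by their roots. -/
lemma geomRep_mem_span_of_commute {a b : B → ℝ} (hab : 1 < |stdForm M a b|)
    (haa : stdForm M a a = 1) (hbb : stdForm M b b = 1) {s t : W}
    (hs : geomRep cs s = refl M a) (ht : geomRep cs t = refl M b) (hss : s * s = 1)
    (htt : t * t = 1) {w : W} {m : ℕ} (hm : 0 < m) (hw : Commute w ((s * t) ^ m)) :
    geomRep cs w a ∈ Submodule.span ℝ {a, b} := by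
  set P := Submodule.span ℝ {a, b} with hP
  have haP : a ∈ P := Submodule.subset_span (by simp)
  have hbP : b ∈ P := Submodule.subset_span (by simp)
  set h := s * t with hh
  have hsub (n : ℕ) (v : B → ℝ) : geomRep cs (h ^ n) v - v ∈ P := by
    induction n with
    | zero => simp
    | succ n ih =>
      rw [pow_succ', geomRep_mul_apply, hh, geomRep_mul_apply, ← hh, hs, ht]
      set y := geomRep cs (h ^ n) v
      have := P.add_mem (P.add_mem (refl_sub_mem (M := M) haP (refl M b y))
        (refl_sub_mem (M := M) hbP y)) ih
      convert this using 1
      abel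
  let f : P →ₗ[ℝ] P := LinearMap.codRestrict P
    ((geomRep cs (h ^ m) - LinearMap.id).comp P.subtype) fun p => hsub m p
  have hf : Function.Injective f := by
    rw [← LinearMap.ker_eq_bot, LinearMap.ker_eq_bot']
    rintro ⟨p, hp⟩ hfp
    have hfix : geomRep cs (h ^ m) p = p := sub_eq_zero.1 (congrArg Subtype.val hfp)
    let X : Set (B → ℝ) :=
      {y | ∃ n : ℕ, y = geomRep cs (h ^ n) p ∨ y = geomRep cs (s * h ^ n) p}
    have hXa : ∀ x ∈ X, refl M a x ∈ X := by
      rintro _ ⟨n, rfl | rfl⟩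
      · exact ⟨n, Or.inr (by rw [← hs, ← geomRep_mul_apply])⟩
      · exact ⟨n, Or.inl (by rw [← hs, ← geomRep_mul_apply, ← mul_assoc, hss, one_mul])⟩
    have hXb : ∀ x ∈ X, refl M b x ∈ X := by
      rintro _ ⟨n, rfl | rfl⟩
      · refine ⟨n + 1, Or.inr ?_⟩
        rw [← ht, ← geomRep_mul_apply, pow_succ', ← mul_assoc s, hh, ← mul_assoc s, hss, one_mul]
      · refine ⟨n + (m - 1), Or.inl ?_⟩
        rw [← ht, ← geomRep_mul_apply]
        nth_rw 1 [← hfix]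
        rw [← geomRep_mul_apply]
        congr 2
        have hinv : t * s = h⁻¹ := by
          rw [hh, mul_inv_rev, inv_eq_of_mul_eq_one_left hss, inv_eq_of_mul_eq_one_left htt]
        obtain ⟨k, rfl⟩ : ∃ k, m = k + 1 := ⟨m - 1, by omega⟩
        rw [← mul_assoc, hinv, mul_assoc, ← pow_add, ← add_assoc, pow_succ', inv_mul_cancel_left]
        rfl
    have hbound (n : ℕ) : |stdForm M a (geomRep cs (h ^ n) p)| ≤
        ∑ k ∈ Finset.range m, |stdForm M a (geomRep cs (h ^ k) p)| := by
      induction n using Nat.strong_induction_on with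
      | _ n IH =>
      by_cases hn : n < m
      · exact Finset.single_le_sum (f := fun k => |stdForm M a (geomRep cs (h ^ k) p)|)
          (fun _ _ => abs_nonneg _) (Finset.mem_range.2 hn)
      · have := IH (n - m) (by omega)
        rwa [← hfix, ← geomRep_mul_apply, ← pow_add, Nat.sub_add_cancel (by omega), hfix] at this
    have hA : ∀ x ∈ X, |stdForm M a x| ≤
        ∑ k ∈ Finset.range m, |stdForm M a (geomRep cs (h ^ k) p)| := by
      rintro _ ⟨n, rfl | rfl⟩
      · exact hbound n
      · have e : stdForm M a (geomRep cs (s * h ^ n) p) =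
            -stdForm M a (geomRep cs (h ^ n) p) := by
          rw [geomRep_mul_apply, hs, refl_apply, map_sub, map_smul, haa, smul_eq_mul]
          ring
        rw [e, abs_neg]
        exact hbound n
    obtain ⟨ha0, hb0⟩ := stdForm_eq_zero_of_bounded hab hXa hXb hA
      (x := p) ⟨0, Or.inl (by simp)⟩
    obtain ⟨x, y, rfl⟩ := Submodule.mem_span_pair.1 hp
    simp only [map_add, map_smul, haa, hbb, smul_eq_mul, stdForm_comm M b a] at ha0 hb0
    have hc2 : 1 < stdForm M a b ^ 2 := by rw [← sq_abs]; nlinarith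
    have hne : stdForm M a b ^ 2 - 1 ≠ 0 := by linarith
    have hy : y * (stdForm M a b ^ 2 - 1) = 0 := by linear_combination stdForm M a b * ha0 - hb0
    have hx : x * (stdForm M a b ^ 2 - 1) = 0 := by linear_combination stdForm M a b * hb0 - ha0
    have hy0 := (mul_eq_zero.1 hy).resolve_right hne
    have hx0 := (mul_eq_zero.1 hx).resolve_right hne
    exact Subtype.ext (by simp [hx0, hy0])
  obtain ⟨⟨p, hp⟩, hpa⟩ := (LinearMap.injective_iff_surjective.1 hf) ⟨a, haP⟩
  have hpa' : geomRep cs (h ^ m) p - p = a := congrArg Subtype.val hpa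
  rw [← hpa', map_sub, ← geomRep_mul_apply, hw.eq, geomRep_mul_apply]
  exact hsub m _

/-- Every simple root lies in two distinct planes spanned by it and another root, on each of which
the standard form is indefinite. -/
lemma exists_two_hyperbolic_planes (hirr : IsIrreducible M) (h : ¬ IsPosSemidef M) (i : B) :
    ∃ (k : B) (g d : W),
      1 < |stdForm M (simpleRoot i) (geomRep cs g (simpleRoot i))| ∧
      1 < |stdForm M (simpleRoot i) (geomRep cs d (simpleRoot k))| ∧
      geomRep cs d (simpleRoot k) ∉
        Submodule.span ℝ {simpleRoot i, geomRep cs g (simpleRoot i)} := by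
  obtain ⟨g, hg⟩ := exists_lt_abs_stdForm cs hirr h i i 1
  set a : B → ℝ := simpleRoot i
  set b := geomRep cs g a
  set P := Submodule.span ℝ {a, b} with hP
  have haP : a ∈ P := Submodule.subset_span (by simp)
  have hbP : b ∈ P := Submodule.subset_span (by simp)
  obtain ⟨k, hkP, hk⟩ : ∃ k, simpleRoot k ∉ P ∧
      ¬ (stdForm M a (simpleRoot k) = 0 ∧ stdForm M b (simpleRoot k) = 0) := by
    by_contra! hcon
    have hstep {k l : B} (hkl : (coxeterGraph M).Adj k l) (hk : simpleRoot k ∈ P) :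
        simpleRoot l ∈ P := by
      by_contra hl
      obtain ⟨h1, h2⟩ := hcon l hl
      obtain ⟨x, y, hxy⟩ := Submodule.mem_span_pair.1 hk
      apply formEntry_ne_zero_of_adj M hkl
      rw [← stdForm_root_root, ← hxy]
      simp [h1, h2]
    have hwalk {k l : B} (p : (coxeterGraph M).Walk k l) (hl : simpleRoot l ∈ P) :
        simpleRoot k ∈ P := by
      induction p with
      | nil => exact hl
      | cons hkl _ ih => exact hstep hkl.symm (ih hl)
    have hall (k : B) : simpleRoot k ∈ P := (hirr.preconnected k i).elim fun p => hwalk p haP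
    have htop : P = ⊤ := by
      rw [eq_top_iff]
      intro v _
      rw [← sum_smul_simpleRoot v]
      exact P.sum_mem fun k _ => P.smul_mem _ (hall k)
    have hcard := two_lt_card h
    have hfr : Module.finrank ℝ P ≤ 2 := by
      classical
      have := finrank_span_finset_le_card (R := ℝ) ({a, b} : Finset (B → ℝ))
      rw [Set.finrank, Finset.coe_pair] at this
      exact this.trans Finset.card_le_two
    rw [htop, finrank_top, Module.finrank_fintype_fun_eq_card] at hfr
    omega
  let X : Set (B → ℝ) := {x | x - simpleRoot k ∈ P ∧ ∃ d : W, x = geomRep cs d (simpleRoot k)}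
  have hX {u : B → ℝ} (huP : u ∈ P) {s : W} (hs : geomRep cs s = refl M u) :
      ∀ x ∈ X, refl M u x ∈ X := by
    rintro x ⟨hx, d, hd⟩
    refine ⟨?_, s * d, by rw [geomRep_mul_apply, hs, hd]⟩
    have := P.add_mem (refl_sub_mem (M := M) huP x) hx
    rwa [sub_add_sub_cancel] at this
  obtain ⟨x, ⟨hxP, d, rfl⟩, hx⟩ : ∃ x ∈ X, 1 < |stdForm M a x| := by
    by_contra! hcon
    exact hk (stdForm_eq_zero_of_bounded hg (hX haP (geomRep_simple cs i))
      (hX hbP (geomRep_conj_simple cs g i)) hcon ⟨by simp, 1, by simp⟩)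
  refine ⟨k, g, d, hg, hx, fun hd => hkP ?_⟩
  have := P.sub_mem hd hxP
  rwa [sub_sub_cancel] at this

end HyperbolicPlanes

section FiniteConjugacyClasses

variable {B W : Type*} [Fintype B] [Group W] {M : CoxeterMatrix B} (cs : CoxeterSystem M W)

lemma exists_commute_pow_of_finite {G : Type*} [Group G] {w : G}
    (hw : (Set.range fun g : G => g * w * g⁻¹).Finite) (h : G) :
    ∃ m : ℕ, 0 < m ∧ Commute w (h ^ m) := by
  have hfin : Finite (Set.range fun g : G => g * w * g⁻¹) := hw
  obtain ⟨x, y, hne, heq⟩ := Finite.exists_ne_map_eq_of_infinite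
    fun n : ℕ => (⟨h ^ n * w * (h ^ n)⁻¹, h ^ n, rfl⟩ : Set.range fun g : G => g * w * g⁻¹)
  have key {x y : ℕ} (hlt : x < y) (heq : h ^ x * w * (h ^ x)⁻¹ = h ^ y * w * (h ^ y)⁻¹) :
      ∃ m : ℕ, 0 < m ∧ Commute w (h ^ m) := by
    refine ⟨y - x, by omega, ?_⟩
    obtain ⟨k, rfl⟩ : ∃ k, y = x + k := ⟨y - x, by omega⟩
    rw [Nat.add_sub_cancel_left]
    rw [pow_add, mul_inv_rev] at heq
    have h1 : w = h ^ k * w * (h ^ k)⁻¹ := by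
      have := congrArg (fun z => (h ^ x)⁻¹ * z * h ^ x) heq
      simpa [mul_assoc] using this
    exact eq_mul_inv_iff_mul_eq.1 h1
  have heq' := congrArg Subtype.val heq
  rcases lt_or_gt_of_ne hne with hlt | hlt
  · exact key hlt heq'
  · exact key hlt heq'.symm

/-- The geometric action of an element with finite conjugacy class preserves the line spanned by
each simple root. -/
lemma geomRep_root_eq_of_finite (hirr : IsIrreducible M) (h : ¬ IsPosSemidef M) {w : W}
    (hw : (Set.range fun g : W => g * w * g⁻¹).Finite) (i : B) :
    ∃ ε : ℝ, geomRep cs w (simpleRoot i) = ε • simpleRoot i := by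
  obtain ⟨k, g, d, hg, hd, hdP⟩ := exists_two_hyperbolic_planes cs hirr h i
  have mem_span (x : W) (l : B)
      (hx : 1 < |stdForm M (simpleRoot i) (geomRep cs x (simpleRoot l))|) :
      geomRep cs w (simpleRoot i) ∈
        Submodule.span ℝ {simpleRoot i, geomRep cs x (simpleRoot l)} := by
    obtain ⟨m, hm, hcomm⟩ :=
      exists_commute_pow_of_finite hw (cs.simple i * (x * cs.simple l * x⁻¹))
    exact geomRep_mem_span_of_commute cs hx (stdForm_root_self M i)
      (by rw [stdForm_geomRep, stdForm_root_self]) (geomRep_simple cs i)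
      (geomRep_conj_simple cs x l) (cs.simple_mul_simple_self i) (by simp [mul_assoc]) hm hcomm
  obtain ⟨x, y, hxy⟩ := Submodule.mem_span_pair.1 (mem_span d k hd)
  have hy : y = 0 := by
    by_contra hy
    apply hdP
    have h1 := Submodule.sub_mem _ (mem_span g i hg) (Submodule.smul_mem _ x
      (Submodule.subset_span (by simp : simpleRoot i ∈
        ({simpleRoot i, geomRep cs g (simpleRoot i)} : Set (B → ℝ)))))
    rw [← hxy, add_sub_cancel_left] at h1
    exact (Submodule.smul_mem_iff _ hy).1 h1
  exact ⟨x, by rw [← hxy, hy, zero_smul, add_zero]⟩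

/-- An element with finite conjugacy class acts as a scalar in the geometric representation. -/
lemma exists_geomRep_eq_smul_of_finite (hirr : IsIrreducible M) (h : ¬ IsPosSemidef M) {w : W}
    (hw : (Set.range fun g : W => g * w * g⁻¹).Finite) :
    ∃ ε : ℝ, ε ^ 2 = 1 ∧ ∀ v, geomRep cs w v = ε • v := by
  choose ε hε using geomRep_root_eq_of_finite cs hirr h hw
  have hmul (i j : B) : ε i * ε j * formEntry M i j = formEntry M i j := by
    have := stdForm_geomRep cs w (simpleRoot i) (simpleRoot j)
    rw [hε, hε] at this
    simp only [map_smul, LinearMap.smul_apply, smul_eq_mul, stdForm_root_root] at this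
    linarith
  have hsq (i : B) : ε i ^ 2 = 1 := by
    have := hmul i i
    rw [formEntry_self] at this
    linarith
  have hadj {i j : B} (hij : (coxeterGraph M).Adj i j) : ε i = ε j := by
    have h1 : ε i * ε j = 1 := mul_right_cancel₀ (formEntry_ne_zero_of_adj M hij)
      (by rw [hmul, one_mul])
    linear_combination ε j * h1 - ε i * hsq j
  obtain ⟨i₀⟩ := hirr.nonempty
  have hall (i : B) : ε i = ε i₀ := by
    obtain ⟨p⟩ := hirr.preconnected i i₀
    induction p with
    | nil => rfl
    | cons hkl _ ih => exact (hadj hkl).trans ih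
  refine ⟨ε i₀, hsq i₀, fun v => ?_⟩
  conv_lhs => rw [← sum_smul_simpleRoot v]
  conv_rhs => rw [← sum_smul_simpleRoot v]
  rw [map_sum, Finset.smul_sum]
  exact Finset.sum_congr rfl fun i _ => by rw [map_smul, hε, hall, smul_comm]

end FiniteConjugacyClasses

/-- In an irreducible, infinite, non-affine Coxeter group, the
conjugacy class of any element `w ≠ 1` is infinite. -/
theorem conjugacy_class_infinite
    {B W : Type*} [Fintype B] [Group W] {M : CoxeterMatrix B} (cs : CoxeterSystem M W)
    (hirr : IsIrreducible M) (hinf : Infinite W)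
    (hnonaff : ¬ IsPosDef M ∧ ¬ IsPosSemidef M)
    (w : W) (hw : w ≠ 1) :
    (Set.range fun g : W => g * w * g⁻¹).Infinite := by
  intro hfin
  obtain ⟨ε, hε, hact⟩ := exists_geomRep_eq_smul_of_finite cs hirr hnonaff.2 hfin
  obtain ⟨i, hi⟩ := cs.exists_rightDescent_of_ne_one hw
  have hεneg : ε < 0 := by
    have h1 := geomRep_root_nonpos cs w i hi i
    rw [hact] at h1
    have h2 : ε ≤ 0 := by simpa [simpleRoot] using h1
    refine h2.lt_of_ne ?_
    rintro rfl
    norm_num at hε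
  obtain ⟨v, hv, hv0, μ, hμ, heig⟩ := exists_nonneg_eigenvector hnonaff.2
  have hle := le_geomRep_of_antidominant cs (v := v)
    (fun j => by rw [heig]; nlinarith [hv j, show (0 : ℝ) ≤ v j from hv j]) w
  rw [hact] at hle
  apply hv0
  refine le_antisymm (fun j => ?_) hv
  have h1 : v j ≤ ε * v j := hle j
  have h2 : 0 ≤ v j := hv j
  change v j ≤ 0
  nlinarith

end CoxeterPaper
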